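/- arXiv:1806.09305 — 2 statements merged into one kernel-verified Lean document; each statement's English description precedes it below -/
import Mathlib

section
/- Let (T,X) be an invertible minimal semiflow admitting an invariant measure. Then for every x ∈ X: Q[x] = D[x] = cls(V[x]), i.e. the regionally proximal cell of x equals Veech's relation cell D[x] and equals the closure of Veech's relation cell V[x]. -/
open Filter Topology Set Function MeasureTheory
open scoped Uniformity symmDiff

universe u v

/-- The orbit `T x` of a point `x` under the action of `T`. -/
def orbitSet (T : Type*) {X : Type*} [SMul T X] (x : X) : Set X :=
  Set.range fun t : T => t • x

/-- A semiflow is minimal iff every orbit is dense. -/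
def SFMinimal (T : Type*) (X : Type*) [SMul T X] [TopologicalSpace X] : Prop :=
  ∀ x : X, Dense (orbitSet T x)

/-- `μ` is an invariant (Borel) probability measure for the semiflow `(T,X)`:
`μ (t⁻¹ B) = μ B` for every Borel set `B` and every `t ∈ T`. -/
def SFInvariantMeasure (T : Type*) {X : Type*} [SMul T X] [MeasurableSpace X]
    (μ : Measure X) : Prop :=
  IsProbabilityMeasure μ ∧
    ∀ (t : T) (B : Set X), MeasurableSet B → μ ((fun x => t • x) ⁻¹' B) = μ B

/-- Topological transitivity: for all nonempty open `U V`, some `t` has `U ∩ t⁻¹V ≠ ∅`. -/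
def SFTopTransitive (T : Type*) (X : Type*) [SMul T X] [TopologicalSpace X] : Prop :=
  ∀ U V : Set X, IsOpen U → U.Nonempty → IsOpen V → V.Nonempty →
    ∃ t : T, (U ∩ (fun x => t • x) ⁻¹' V).Nonempty

/-- Weak mixing: the diagonal product semiflow on `X × X` is topologically transitive. -/
def SFWeakMixing (T : Type*) (X : Type*) [SMul T X] [TopologicalSpace X] : Prop :=
  SFTopTransitive T (X × X)

/-- The regionally proximal relation `Q(X)`: `(x,x')` such that there are nets
`xₙ → x`, `xₙ' → x'` and `tₙ` in `T` with `lim tₙxₙ = lim tₙxₙ'`. -/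
def SFRegionallyProximal (T : Type*) (X : Type*) [SMul T X] [UniformSpace X] :
    Set (X × X) :=
  ⋂ ε ∈ 𝓤 X, closure {p : X × X | ∃ t : T, (t • p.1, t • p.2) ∈ ε}

/-- Equicontinuity of a semiflow on a (compact) uniform space. -/
def SFEquicontinuous (T : Type*) (X : Type*) [SMul T X] [UniformSpace X] : Prop :=
  ∀ ε ∈ 𝓤 X, ∃ δ ∈ 𝓤 X, ∀ p : X × X, p ∈ δ → ∀ t : T, (t • p.1, t • p.2) ∈ ε

/-- Distality of a semiflow. -/
def SFDistal (T : Type*) (X : Type*) [SMul T X] [UniformSpace X] : Prop :=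
  ∀ x x' : X, x ≠ x' → ∃ ε ∈ 𝓤 X, ∀ t : T, (t • x, t • x') ∉ ε

/-- `x` and `y` are proximal: some net `tₙ` has `tₙx → z` and `tₙy → z`. -/
def SFProximal (T : Type*) {X : Type*} [SMul T X] [TopologicalSpace X] (x y : X) : Prop :=
  ∃ z : X, (z, z) ∈ closure (Set.range fun t : T => (t • x, t • y))

/-- `x` is a distal point: no point of its orbit closure other than `x` is proximal to `x`. -/
def SFDistalPoint (T : Type*) {X : Type*} [SMul T X] [TopologicalSpace X] (x : X) : Prop :=
  ∀ y ∈ closure (orbitSet T x), SFProximal T x y → y = x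

/-- A relation `R ⊆ X × X` is invariant under the action. -/
def SFInvariantRel (T : Type*) {X : Type*} [SMul T X] (R : Set (X × X)) : Prop :=
  ∀ (t : T), ∀ p ∈ R, (t • p.1, t • p.2) ∈ R

/-- `x` is a minimal (almost periodic) point: its orbit closure is a minimal set. -/
def SFMinimalPoint (T : Type*) {X : Type*} [SMul T X] [TopologicalSpace X] (x : X) : Prop :=
  ∀ y ∈ closure (orbitSet T x), closure (orbitSet T y) = closure (orbitSet T x)

/-- `R` is the fiber relation of some equicontinuous factor of `(T,X)`; equivalently,
`R` is a closed invariant equivalence relation such that the induced semiflow on `X/R`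
is equicontinuous. -/
def SFIsEqFactorRel (T : Type*) (X : Type u) [Monoid T] [TopologicalSpace T]
    [TopologicalSpace X] [MulAction T X] (R : Set (X × X)) : Prop :=
  ∃ (Y : Type u) (_ : UniformSpace Y) (_ : CompactSpace Y) (_ : T2Space Y)
    (_ : MulAction T Y) (_ : ContinuousSMul T Y) (π : X → Y),
      Continuous π ∧ Function.Surjective π ∧
      (∀ (t : T) (x : X), π (t • x) = t • π x) ∧
      SFEquicontinuous T Y ∧ R = {p : X × X | π p.1 = π p.2}

/-- `S` is the equicontinuous structure relation `S_eq(X)`: the smallest closed invariant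
equivalence relation whose quotient semiflow is equicontinuous. -/
def SFIsEqStructureRel (T : Type*) (X : Type u) [Monoid T] [TopologicalSpace T]
    [TopologicalSpace X] [MulAction T X] (S : Set (X × X)) : Prop :=
  SFIsEqFactorRel T X S ∧ ∀ R : Set (X × X), SFIsEqFactorRel T X R → S ⊆ R

/-- `R` is the fiber relation of some equicontinuous *and invertible* factor of `(T,X)`. -/
def SFIsEqInvFactorRel (T : Type*) (X : Type u) [Monoid T] [TopologicalSpace T]
    [TopologicalSpace X] [MulAction T X] (R : Set (X × X)) : Prop :=
  ∃ (Y : Type u) (_ : UniformSpace Y) (_ : CompactSpace Y) (_ : T2Space Y)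
    (_ : MulAction T Y) (_ : ContinuousSMul T Y) (π : X → Y),
      Continuous π ∧ Function.Surjective π ∧
      (∀ (t : T) (x : X), π (t • x) = t • π x) ∧
      SFEquicontinuous T Y ∧ (∀ t : T, Function.Bijective fun y : Y => t • y) ∧
      R = {p : X × X | π p.1 = π p.2}

/-- `(T,X)` has a nontrivial distal factor. -/
def SFHasNontrivialDistalFactor (T : Type*) (X : Type u) [Monoid T] [TopologicalSpace T]
    [TopologicalSpace X] [MulAction T X] : Prop :=
  ∃ (Z : Type u) (_ : UniformSpace Z) (_ : CompactSpace Z) (_ : T2Space Z)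
    (_ : MulAction T Z) (_ : ContinuousSMul T Z) (π : X → Z),
      Continuous π ∧ Function.Surjective π ∧
      (∀ (t : T) (x : X), π (t • x) = t • π x) ∧
      SFDistal T Z ∧ Nontrivial Z

/-- `(T,X)` has a nontrivial equicontinuous factor. -/
def SFHasNontrivialEqFactor (T : Type*) (X : Type u) [Monoid T] [TopologicalSpace T]
    [TopologicalSpace X] [MulAction T X] : Prop :=
  ∃ (Z : Type u) (_ : UniformSpace Z) (_ : CompactSpace Z) (_ : T2Space Z)
    (_ : MulAction T Z) (_ : ContinuousSMul T Z) (π : X → Z),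
      Continuous π ∧ Function.Surjective π ∧
      (∀ (t : T) (x : X), π (t • x) = t • π x) ∧
      SFEquicontinuous T Z ∧ Nontrivial Z

/-- `T` is amenable: every semiflow with phase semigroup `T` on a compact Hausdorff
space admits an invariant Borel probability measure. -/
def SFAmenable (T : Type*) [Monoid T] [TopologicalSpace T] : Prop :=
  ∀ (Y : Type u) (_ : TopologicalSpace Y) (_ : CompactSpace Y) (_ : T2Space Y)
    (_ : MulAction T Y) (_ : ContinuousSMul T Y) (_ : MeasurableSpace Y) (_ : BorelSpace Y),
    ∃ μ : Measure Y, SFInvariantMeasure T μ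

/-- `A ⊆ T` is discretely thick: every finite `F ⊆ T` has `F t ⊆ A` for some `t`. -/
def DiscretelyThick (T : Type*) [Monoid T] (A : Set T) : Prop :=
  ∀ F : Finset T, ∃ t : T, ∀ f ∈ F, f * t ∈ A

/-- `A ⊆ T` is discretely syndetic: for some finite `K ⊆ T`, `K t ∩ A ≠ ∅` for all `t`. -/
def DiscretelySyndetic (T : Type*) [Monoid T] (A : Set T) : Prop :=
  ∃ K : Finset T, ∀ t : T, ∃ k ∈ K, k * t ∈ A

/-- `x` is a locally almost periodic point. -/
def SFLapPoint (T : Type*) {X : Type*} [Monoid T] [SMul T X] [TopologicalSpace X]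
    (x : X) : Prop :=
  ∀ U ∈ 𝓝 x, ∃ V ∈ 𝓝 x, ∃ A : Set T, DiscretelySyndetic T A ∧
    ∀ a ∈ A, ∀ y ∈ V, a • y ∈ U

/-- `(T,Y)` is an E-semiflow: topologically transitive with full ergodic center,
i.e. the only closed invariant subset of full measure for every invariant measure
is `Y` itself. -/
def SFIsESemiflow (T : Type*) (Y : Type*) [SMul T Y] [TopologicalSpace Y]
    [MeasurableSpace Y] : Prop :=
  SFTopTransitive T Y ∧
    ∀ C : Set Y, IsClosed C → (∀ (t : T), ∀ y ∈ C, t • y ∈ C) →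
      (∀ μ : Measure Y, SFInvariantMeasure T μ → μ C = 1) → C = Set.univ

/-- Veech's relation `V`: `x' ∈ V[x]` iff there are a net `xₙ' → x'`, a point `y`, and a
net `tₙ` in `T` with `tₙ x → y` and `tₙ xₙ' = y`. -/
def SFVeechV (T : Type*) {X : Type*} [SMul T X] [UniformSpace X] (x : X) : Set X :=
  {x' : X | ∃ y : X, ∀ ε ∈ 𝓤 X, ∃ (x'' : X) (t : T),
    (x', x'') ∈ ε ∧ (y, t • x) ∈ ε ∧ t • x'' = y}

/-- Veech's relation `D`: `D[x] = ⋂_ε cls (A⁻¹ A x)` where `A = N_T(x, ε[x])`. -/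
def SFVeechD (T : Type*) {X : Type*} [SMul T X] [UniformSpace X] (x : X) : Set X :=
  ⋂ ε ∈ 𝓤 X, closure {z : X | ∃ t : T, (x, t • x) ∈ ε ∧
    ∃ s : T, (x, s • x) ∈ ε ∧ t • z = s • x}

/-- `x` is an almost automorphic point: `V[x] = {x}`, i.e. whenever `tₙ x → y`,
`xₙ' → x'`, `tₙ xₙ' = y`, then `x = x'`. -/
def SFAAPoint (T : Type*) {X : Type*} [SMul T X] [UniformSpace X] (x : X) : Prop :=
  ∀ x' ∈ SFVeechV T x, x' = x

/-- A surjective semiflow is bi-continuous if each set-valued map `x ↦ t⁻¹x` is continuous. -/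
def SFBiContinuous (T : Type*) (X : Type*) [SMul T X] [UniformSpace X] : Prop :=
  (∀ t : T, Function.Surjective fun x : X => t • x) ∧
  ∀ (t : T) (x₀ : X), ∀ ε ∈ 𝓤 X, ∃ δ ∈ 𝓤 X, ∀ x : X, (x₀, x) ∈ δ →
    (∀ z : X, t • z = x → ∃ w : X, t • w = x₀ ∧ (w, z) ∈ ε) ∧
    (∀ w : X, t • w = x₀ → ∃ z : X, t • z = x ∧ (w, z) ∈ ε)

/-- The McMahon pseudo-metric `D_J(x,x') = μ (J_x △ J_{x'})`. -/
noncomputable def mcmahonDJ {X : Type*} {Y : Type*} [MeasurableSpace Y] (μ : Measure Y)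
    (J : Set (X × Y)) (x x' : X) : ℝ :=
  (μ ({y : Y | (x, y) ∈ J} ∆ {y : Y | (x', y) ∈ J})).toReal

/-- The slices of a closed set are upper semicontinuous when the second factor is compact. -/
theorem eventually_slice_subset {X Y : Type*} [TopologicalSpace X] [TopologicalSpace Y]
    [CompactSpace Y] {J : Set (X × Y)} (hJ : IsClosed J) {z : X} {U : Set Y} (hU : IsOpen U)
    (hz : Prod.mk z ⁻¹' J ⊆ U) : ∀ᶠ a in 𝓝 z, Prod.mk a ⁻¹' J ⊆ U := by
  have hcl : IsClosed (Prod.fst '' (J ∩ Prod.snd ⁻¹' Uᶜ)) :=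
    isClosedMap_fst_of_compactSpace _ (hJ.inter (hU.isClosed_compl.preimage continuous_snd))
  have hzmem : z ∉ Prod.fst '' (J ∩ Prod.snd ⁻¹' Uᶜ) := by
    rintro ⟨⟨a, y⟩, ⟨hy, hyU⟩, rfl⟩
    exact hyU (hz hy)
  filter_upwards [hcl.isOpen_compl.mem_nhds hzmem] with a ha y hy
  by_contra hyU
  exact ha ⟨(a, y), ⟨hy, hyU⟩, rfl⟩

theorem measurableSet_slice {X Y : Type*} [TopologicalSpace X] [TopologicalSpace Y]
    [MeasurableSpace Y] [BorelSpace Y] {J : Set (X × Y)} (hJ : IsClosed J) (z : X) :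
    MeasurableSet (Prod.mk z ⁻¹' J) :=
  (hJ.preimage (by fun_prop : Continuous (Prod.mk z))).measurableSet

theorem eventually_measure_slice_sdiff_lt {X Y : Type*} [TopologicalSpace X] [TopologicalSpace Y]
    [CompactSpace Y] [MeasurableSpace Y] [BorelSpace Y] {μ : Measure Y} [IsFiniteMeasure μ]
    [μ.OuterRegular] {J : Set (X × Y)} (hJ : IsClosed J) (z : X) {δ : ENNReal} (hδ : δ ≠ 0) :
    ∀ᶠ a in 𝓝 z, μ (Prod.mk a ⁻¹' J \ Prod.mk z ⁻¹' J) < δ := by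
  obtain ⟨U, hzU, hU, -, hlt⟩ :=
    (measurableSet_slice hJ z).exists_isOpen_sdiff_lt (measure_ne_top μ _) hδ
  filter_upwards [eventually_slice_subset hJ hU hzU] with a ha
  exact (measure_mono (sdiff_subset_sdiff_left ha)).trans_lt hlt

/-- For a closed invariant subset of the product of a minimal semiflow and a semiflow with an
invariant measure, all slices have the same measure. -/
theorem measure_slice_eq {T X Y : Type*} [SMul T X] [SMul T Y] [TopologicalSpace X]
    [TopologicalSpace Y] [CompactSpace Y] [MeasurableSpace Y] [BorelSpace Y]
    (hmin : SFMinimal T X) {μ : Measure Y} [μ.OuterRegular] (hμ : SFInvariantMeasure T μ)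
    {J : Set (X × Y)} (hJ : IsClosed J)
    (hinv : ∀ (t : T) (x : X) (y : Y), (x, y) ∈ J → (t • x, t • y) ∈ J) (a b : X) :
    μ (Prod.mk a ⁻¹' J) = μ (Prod.mk b ⁻¹' J) := by
  have := hμ.1
  suffices h : ∀ a b : X, μ (Prod.mk a ⁻¹' J) ≤ μ (Prod.mk b ⁻¹' J) from (h a b).antisymm (h b a)
  intro a b
  refine ENNReal.le_of_forall_pos_le_add fun δ hδ _ => ?_
  have hev := eventually_measure_slice_sdiff_lt (μ := μ) hJ b
    (ENNReal.coe_ne_zero.2 hδ.ne')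
  obtain ⟨-, hlt, t, rfl⟩ := mem_closure_iff_nhds.1 (hmin a b) _ hev
  calc μ (Prod.mk a ⁻¹' J)
      ≤ μ ((fun y => t • y) ⁻¹' (Prod.mk (t • a) ⁻¹' J)) :=
        measure_mono fun y hy => hinv t a y hy
    _ = μ (Prod.mk (t • a) ⁻¹' J) := hμ.2 t _ (measurableSet_slice hJ _)
    _ ≤ μ (Prod.mk b ⁻¹' J) + μ (Prod.mk (t • a) ⁻¹' J \ Prod.mk b ⁻¹' J) := by
        rw [add_comm]
        exact (measure_mono (by rw [sdiff_union_self]; exact subset_union_left)).trans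
          (measure_union_le _ _)
    _ ≤ μ (Prod.mk b ⁻¹' J) + δ := by gcongr; exact hlt.le

theorem measure_sdiff_le_add {Y : Type*} [MeasurableSpace Y] (μ : Measure Y) (A B C : Set Y) :
    μ (A \ C) ≤ μ (A \ B) + μ (B \ C) :=
  (measure_mono (sdiff_triangle A B C)).trans (measure_union_le _ _)

/-- McMahon's lemma: regionally proximal points have almost equal slices. -/
theorem measure_slice_sdiff_eq_zero {T X Y : Type*} [SMul T X] [SMul T Y] [UniformSpace X]
    [CompactSpace X] [TopologicalSpace Y] [CompactSpace Y] [ContinuousConstSMul T Y]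
    [MeasurableSpace Y] [BorelSpace Y]
    (hmin : SFMinimal T X) {μ : Measure Y} [μ.OuterRegular] (hμ : SFInvariantMeasure T μ)
    {J : Set (X × Y)} (hJ : IsClosed J)
    (hinv : ∀ (t : T) (x : X) (y : Y), (x, y) ∈ J → (t • x, t • y) ∈ J) {x x' : X}
    (hx : (x, x') ∈ SFRegionallyProximal T X) :
    μ (Prod.mk x ⁻¹' J \ Prod.mk x' ⁻¹' J) = 0 := by
  have := hμ.1
  have hmeas := fun z => measurableSet_slice hJ z
  have heq := measure_slice_eq hmin hμ hJ hinv
  have hsymm (a b : X) :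
      μ (Prod.mk a ⁻¹' J \ Prod.mk b ⁻¹' J) = μ (Prod.mk b ⁻¹' J \ Prod.mk a ⁻¹' J) :=
    measure_sdiff_symm (hmeas a).nullMeasurableSet (hmeas b).nullMeasurableSet (heq a b)
      (measure_ne_top _ _)
  have htrans (t : T) (a b : X) : μ (Prod.mk a ⁻¹' J \ Prod.mk b ⁻¹' J) =
      μ (Prod.mk (t • a) ⁻¹' J \ Prod.mk (t • b) ⁻¹' J) := by
    have hae (z : X) :
        Prod.mk z ⁻¹' J =ᵐ[μ] (fun y => t • y) ⁻¹' (Prod.mk (t • z) ⁻¹' J) := by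
      refine ae_eq_of_subset_of_measure_ge (fun y hy => hinv t z y hy) ?_
        (hmeas z).nullMeasurableSet (measure_ne_top _ _)
      rw [hμ.2 t _ (hmeas _), heq (t • z) z]
    rw [← hμ.2 t (Prod.mk (t • a) ⁻¹' J \ _) ((hmeas _).diff (hmeas _)), preimage_sdiff]
    exact measure_congr ((hae a).diff (hae b))
  refine le_antisymm (ENNReal.le_of_forall_pos_le_add fun δ hδ _ => ?_) zero_le
  have hδ4 : (δ / 4 : ENNReal) ≠ 0 := by simp [hδ.ne']
  have hev := fun z => eventually_measure_slice_sdiff_lt (μ := μ) hJ z hδ4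
  have hunif : {p : X × X | μ (Prod.mk p.1 ⁻¹' J \ Prod.mk p.2 ⁻¹' J) ≤ δ / 4 + δ / 4} ∈ 𝓤 X := by
    rw [← nhdsSet_diagonal_eq_uniformity, mem_nhdsSet_iff_forall]
    rintro ⟨z, z'⟩ hz
    obtain rfl : z = z' := hz
    rw [nhds_prod_eq]
    filter_upwards [prod_mem_prod (hev z) (hev z)] with p hp
    refine (measure_sdiff_le_add μ _ (Prod.mk z ⁻¹' J) _).trans (add_le_add hp.1.le ?_)
    rw [hsymm]
    exact hp.2.le
  obtain ⟨⟨a, b⟩, ⟨ha, hb⟩, t, ht⟩ := mem_closure_iff_nhds.1 (mem_iInter₂.1 hx _ hunif) _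
    (prod_mem_nhds (hev x) (hev x'))
  simp only [mem_ofPred_eq] at ha hb ht
  rw [← htrans t a b] at ht
  rw [hsymm] at ha
  calc μ (Prod.mk x ⁻¹' J \ Prod.mk x' ⁻¹' J)
      ≤ δ / 4 + ((δ / 4 + δ / 4) + δ / 4) :=
        (measure_sdiff_le_add μ _ (Prod.mk a ⁻¹' J) _).trans (add_le_add ha.le
          ((measure_sdiff_le_add μ _ (Prod.mk b ⁻¹' J) _).trans (add_le_add ht hb.le)))
    _ = 0 + δ := by
        rw [zero_add, show (δ / 4 : ENNReal) + (δ / 4 + δ / 4 + δ / 4) = 4 * (δ / 4) by ring]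
        exact ENNReal.mul_div_cancel (by simp) (by simp)

/-- An invariant measure on a compact Hausdorff space on which every element acts bijectively
can be replaced by a regular one. -/
theorem exists_regular_invariantMeasure {T X : Type*} [SMul T X] [TopologicalSpace X]
    [CompactSpace X] [T2Space X] [ContinuousConstSMul T X] [MeasurableSpace X] [BorelSpace X]
    (hmeas : ∃ μ : Measure X, SFInvariantMeasure T μ)
    (hinv : ∀ t : T, Function.Bijective fun x : X => t • x) :
    ∃ μ : Measure X, μ.Regular ∧ SFInvariantMeasure T μ := by
  obtain ⟨μ, hμ, hμinv⟩ := hmeas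
  obtain ⟨ν, hν, hνfin, hint⟩ := μ.exists_regular_eq_of_compactSpace
  refine ⟨ν, hν, ⟨?_⟩, fun t B hB => ?_⟩
  · have h := hint (BoundedContinuousFunction.const X 1)
    simp only [BoundedContinuousFunction.const_apply, integral_const, probReal_univ, smul_eq_mul,
      mul_one] at h
    rw [← ENNReal.toReal_eq_one_iff]
    exact h.symm
  · have hcont : Continuous fun x : X => t • x := continuous_const_smul t
    let e : X ≃ₜ X := Continuous.homeoOfEquivCompactToT2 (f := Equiv.ofBijective _ (hinv t)) hcont
    have he : Measure.map (fun x : X => t • x) μ = μ := by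
      ext B hB
      rw [Measure.map_apply hcont.measurable hB, hμinv t B hB]
    have hreg : (Measure.map (fun x : X => t • x) ν).Regular := Measure.Regular.map e
    have hmap : Measure.map (fun x : X => t • x) ν = ν := by
      refine Measure.ext_of_integral_eq_on_compactlySupported fun f => ?_
      let g : BoundedContinuousFunction X ℝ := BoundedContinuousFunction.mkOfCompact f
      have hf : Continuous fun x => f x := f.continuous
      rw [integral_map hcont.aemeasurable hf.aestronglyMeasurable]
      calc ∫ x, f (t • x) ∂ν = ∫ x, f (t • x) ∂μ :=
            (hint (g.compContinuous ⟨_, hcont⟩)).symm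
        _ = ∫ x, f x ∂(Measure.map (fun x : X => t • x) μ) :=
            (integral_map hcont.aemeasurable hf.aestronglyMeasurable).symm
        _ = ∫ x, f x ∂ν := by rw [he]; exact hint g
    rw [← Measure.map_apply hcont.measurable hB, hmap]

/-- An invariant measure of a minimal semiflow has full support. -/
theorem eq_empty_of_measure_eq_zero {T X : Type*} [SMul T X] [TopologicalSpace X]
    [CompactSpace X] [ContinuousConstSMul T X] [MeasurableSpace X] [BorelSpace X]
    (hmin : SFMinimal T X) {μ : Measure X} (hμ : SFInvariantMeasure T μ) {O : Set X}
    (hO : IsOpen O) (h0 : μ O = 0) : O = ∅ := by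
  have := hμ.1
  by_contra hne
  have hcover : (univ : Set X) ⊆ ⋃ t : T, (fun x => t • x) ⁻¹' O := fun x _ => by
    obtain ⟨-, hx, t, rfl⟩ := (hmin x).inter_open_nonempty O hO (nonempty_iff_ne_empty.2 hne)
    exact mem_iUnion.2 ⟨t, hx⟩
  obtain ⟨s, hs⟩ := isCompact_univ.elim_finite_subcover _
    (fun t : T => hO.preimage (continuous_const_smul t)) hcover
  have hnull : μ (⋃ t ∈ s, (fun x => t • x) ⁻¹' O) = 0 :=
    (measure_biUnion_null_iff s.countable_toSet).2 fun t _ => by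
      rw [hμ.2 t O hO.measurableSet, h0]
  exact one_ne_zero (measure_univ.symm.trans (measure_mono_null hs hnull) : (1 : ENNReal) = 0)

theorem exists_smul_mem_of_regionallyProximal {T X : Type*} [Monoid T] [UniformSpace X]
    [CompactSpace X] [T2Space X] [MulAction T X] [ContinuousConstSMul T X]
    [MeasurableSpace X] [BorelSpace X] (hmin : SFMinimal T X)
    (hmeas : ∃ μ : Measure X, SFInvariantMeasure T μ)
    (hinv : ∀ t : T, Function.Bijective fun x : X => t • x) {x x' : X}
    (hx : (x, x') ∈ SFRegionallyProximal T X) {W U : Set X} (hW : IsOpen W) (hx' : x' ∈ W)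
    (hU : IsOpen U) (hUne : U.Nonempty) : ∃ t : T, t • x ∈ U ∧ ∃ w ∈ W, t • w ∈ U := by
  obtain ⟨μ, hreg, hμ⟩ := exists_regular_invariantMeasure hmeas hinv
  let J₀ : Set (X × X) := {p | ∃ t : T, ∃ w ∈ W, (t • x, t • w) = p}
  have hJinv (t : T) (a b : X) (hab : (a, b) ∈ closure J₀) : (t • a, t • b) ∈ closure J₀ := by
    refine map_mem_closure (f := fun p : X × X => (t • p.1, t • p.2)) (by fun_prop) hab ?_
    rintro _ ⟨s, w, hw, rfl⟩
    exact ⟨t * s, w, hw, by simp only [mul_smul]⟩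
  have hWx : W ⊆ Prod.mk x ⁻¹' closure J₀ := fun w hw =>
    subset_closure ⟨1, w, hw, by simp only [one_smul]⟩
  have hdiff : W \ Prod.mk x' ⁻¹' closure J₀ = ∅ :=
    eq_empty_of_measure_eq_zero hmin hμ
      (hW.sdiff (isClosed_closure.preimage (by fun_prop : Continuous (Prod.mk x'))))
      (measure_mono_null (sdiff_subset_sdiff_left hWx)
        (measure_slice_sdiff_eq_zero hmin hμ isClosed_closure hJinv hx))
  have hx'J : (x', x') ∈ closure J₀ := sdiff_eq_empty.1 hdiff hx'
  obtain ⟨-, hs, s, rfl⟩ := (hmin x').inter_open_nonempty U hU hUne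
  obtain ⟨-, ⟨htx, htw⟩, t, w, hw, rfl⟩ := mem_closure_iff.1 (hJinv s x' x' hx'J) (U ×ˢ U)
    (hU.prod hU) ⟨hs, hs⟩
  exact ⟨t, htx, w, hw, htw⟩

theorem mem_closure_veechV {T X : Type*} [SMul T X] [UniformSpace X]
    [CompactSpace X] [T2Space X] [ContinuousConstSMul T X]
    (hinv : ∀ t : T, Function.Bijective fun x : X => t • x) {x x' : X}
    (h : ∀ W U : Set X, IsOpen W → x' ∈ W → IsOpen U → U.Nonempty →
      ∃ t : T, t • x ∈ U ∧ ∃ w ∈ W, t • w ∈ U) :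
    x' ∈ closure (SFVeechV T x) := by
  refine mem_closure_iff_nhds.2 fun N hN => ?_
  obtain ⟨C, hC, hCcl, hCN⟩ := exists_mem_nhds_isClosed_subset hN
  have hopen (t : T) : IsOpen ((fun y : X => t • y) '' interior C) :=
    (Continuous.homeoOfEquivCompactToT2 (f := Equiv.ofBijective _ (hinv t))
      (continuous_const_smul t)).isOpenMap _ isOpen_interior
  have hstep (U : {U : Set X // IsOpen U ∧ U.Nonempty}) :
      ∃ (t : T) (V : {U : Set X // IsOpen U ∧ U.Nonempty}), t • x ∈ U.1 ∧ V.1 ⊆ U.1 ∧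
        closure V.1 ⊆ (fun y : X => t • y) '' interior C := by
    obtain ⟨t, htx, w, hw, htw⟩ := h (interior C) U isOpen_interior
      (mem_interior_iff_mem_nhds.2 hC) U.2.1 U.2.2
    obtain ⟨K, hK, hKcl, hKsub⟩ := exists_mem_nhds_isClosed_subset
      ((U.2.1.inter (hopen t)).mem_nhds ⟨htw, w, hw, rfl⟩)
    exact ⟨t, ⟨interior K, isOpen_interior, _, mem_interior_iff_mem_nhds.2 hK⟩, htx,
      interior_subset.trans (hKsub.trans inter_subset_left),
      (closure_minimal interior_subset hKcl).trans (hKsub.trans inter_subset_right)⟩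
  choose t V htx hVU hVW using hstep
  let U (n : ℕ) : {U : Set X // IsOpen U ∧ U.Nonempty} :=
    V^[n] ⟨univ, isOpen_univ, x, mem_univ x⟩
  have hsucc (n : ℕ) : U (n + 1) = V (U n) := Function.iterate_succ_apply' V n _
  have hanti : Antitone fun n => (U n).1 := antitone_nat_of_succ_le fun n => by
    rw [hsucc]
    exact hVU _
  have hlim (u : ℕ → X) : ∃ y, Tendsto u (hyperfilter ℕ) (𝓝 y) := by
    obtain ⟨y, -, hy⟩ := isCompact_univ.ultrafilter_le_nhds ((hyperfilter ℕ).map u) (by simp)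
    exact ⟨y, hy⟩
  obtain ⟨y, hy⟩ := hlim fun n => t (U n) • x
  have hyW (n : ℕ) : ∃ w ∈ interior C, t (U n) • w = y := by
    refine hVW (U n) (mem_closure_of_tendsto hy ?_)
    filter_upwards [Nat.hyperfilter_le_atTop (eventually_ge_atTop (n + 1))] with k hk
    rw [← hsucc]
    exact hanti hk (htx _)
  choose w hwC hw using hyW
  obtain ⟨z, hz⟩ := hlim w
  refine ⟨z, hCN (hCcl.mem_of_tendsto hz (.of_forall fun n => interior_subset (hwC n))),
    y, fun ε hε => ?_⟩
  obtain ⟨n, hn₁, hn₂⟩ := ((hz.eventually (mem_nhds_left z hε)).and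
    (hy.eventually (mem_nhds_left y hε))).exists
  exact ⟨w n, t (U n), hn₁, hn₂, hw n⟩

theorem mem_veechD {T X : Type*} [SMul T X] [UniformSpace X] (hmin : SFMinimal T X)
    (hinv : ∀ t : T, Function.Bijective fun x : X => t • x)
    [CompactSpace X] [T2Space X] [ContinuousConstSMul T X] {x x' : X}
    (h : ∀ W U : Set X, IsOpen W → x' ∈ W → IsOpen U → U.Nonempty →
      ∃ t : T, t • x ∈ U ∧ ∃ w ∈ W, t • w ∈ U) :
    x' ∈ SFVeechD T x := by
  refine mem_iInter₂.2 fun ε hε => mem_closure_iff.2 fun W hW hx' => ?_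
  obtain ⟨U, hUε, hU, hxU⟩ := mem_nhds_iff.1 (mem_nhds_left x hε)
  obtain ⟨t, htx, w, hw, htw⟩ := h W U hW hx' hU ⟨x, hxU⟩
  have hopen : IsOpen ((fun y : X => t • y) '' W) :=
    (Continuous.homeoOfEquivCompactToT2 (f := Equiv.ofBijective _ (hinv t))
      (continuous_const_smul t)).isOpenMap _ hW
  obtain ⟨-, ⟨hsx, v, hv, hvs⟩, s, rfl⟩ := (hmin x).inter_open_nonempty _ (hU.inter hopen)
    ⟨_, htw, w, hw, rfl⟩
  exact ⟨v, hv, t, hUε htx, s, hUε hsx, hvs⟩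

theorem veechD_subset_regionallyProximal {T X : Type*} [SMul T X] [UniformSpace X] (x : X) :
    SFVeechD T x ⊆ {x' : X | (x, x') ∈ SFRegionallyProximal T X} := by
  refine fun x' hx' => mem_iInter₂.2 fun ε hε => ?_
  obtain ⟨δ, hδ, hsymm, hδε⟩ := comp_symm_mem_uniformity_sets hε
  refine map_mem_closure (f := Prod.mk x) (by fun_prop) (mem_iInter₂.1 hx' δ hδ) ?_
  rintro z ⟨t, ht, s, hs, hts⟩
  refine ⟨t, hδε ⟨x, SetRel.symm δ ht, ?_⟩⟩
  rw [hts]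
  exact hs

theorem closure_veechV_subset_regionallyProximal {T X : Type*} [SMul T X] [UniformSpace X]
    (x : X) : closure (SFVeechV T x) ⊆ {x' : X | (x, x') ∈ SFRegionallyProximal T X} := by
  refine closure_minimal ?_ ((isClosed_biInter fun ε _ => isClosed_closure).preimage
    (by fun_prop : Continuous (Prod.mk x)))
  rintro x' ⟨y, hy⟩
  refine mem_iInter₂.2 fun ε hε => mem_closure_iff_nhds.2 fun N hN => ?_
  have hN' : Prod.mk x ⁻¹' N ∈ 𝓝 x' :=
    (by fun_prop : Continuous (Prod.mk x)).continuousAt.preimage_mem_nhds hN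
  obtain ⟨δ, hδ, hδN⟩ := UniformSpace.mem_nhds_iff.1 hN'
  obtain ⟨z, t, hz, ht, rfl⟩ := hy _ (inter_mem hδ (symm_le_uniformity hε))
  exact ⟨(x, z), hδN hz.1, t, ht.2⟩

/-- For an invertible minimal semiflow `(T,X)` with an invariant measure,
`Q[x] = D[x] = cls(V[x])` for every `x ∈ X`. -/
theorem stmt17 (T : Type*) (X : Type u) [Monoid T] [TopologicalSpace T]
    [UniformSpace X] [CompactSpace X] [T2Space X]
    [MulAction T X] [ContinuousSMul T X]
    [MeasurableSpace X] [BorelSpace X]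
    (hmin : SFMinimal T X)
    (hmeas : ∃ μ : Measure X, SFInvariantMeasure T μ)
    (hinv : ∀ t : T, Function.Bijective fun x : X => t • x) :
    ∀ x : X, {x' : X | (x, x') ∈ SFRegionallyProximal T X} = SFVeechD T x ∧
      SFVeechD T x = closure (SFVeechV T x) := by
  intro x
  have h {x' : X} (hx' : (x, x') ∈ SFRegionallyProximal T X) (W U : Set X) (hW : IsOpen W)
      (hxW : x' ∈ W) (hU : IsOpen U) (hne : U.Nonempty) :=
    exists_smul_mem_of_regionallyProximal hmin hmeas hinv hx' hW hxW hU hne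
  have hQD : {x' : X | (x, x') ∈ SFRegionallyProximal T X} = SFVeechD T x :=
    Subset.antisymm (fun _ hx' => mem_veechD hmin hinv (h hx'))
      (veechD_subset_regionallyProximal x)
  refine ⟨hQD, hQD ▸ Subset.antisymm (fun _ hx' => mem_closure_veechV hinv (h hx'))
    (closure_veechV_subset_regionallyProximal x)⟩
end

section
/- Let (T,X) be a minimal bi-continuous semiflow admitting an invariant measure. Then (T,X) is almost automorphic if and only if the canonical projection π : (T,X) → (T, X_eq) onto its maximal equicontinuous factor is of almost 1-1 type, i.e. there exists a point y ∈ X_eq such that π⁻¹(y) is a singleton. -/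
open Filter Topology Set Function MeasureTheory
open scoped Uniformity symmDiff

universe u v

section Measures

variable {T : Type*} {X : Type u} [Monoid T] [TopologicalSpace T] [TopologicalSpace X]
  [CompactSpace X] [MulAction T X] [ContinuousSMul T X]
  [MeasurableSpace X] [BorelSpace X]

/-- An invariant measure on a compact Hausdorff semiflow may be replaced by a regular one. -/
theorem SFInvariantMeasure.exists_regular [T2Space X] {μ : Measure X} (hμ : SFInvariantMeasure T μ) :
    ∃ ν : Measure X, ν.Regular ∧ SFInvariantMeasure T ν := by
  obtain ⟨hprob, hinv⟩ := hμ
  obtain ⟨ν, hreg, hfin, hint⟩ := Measure.exists_regular_eq_of_compactSpace μ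
  have hcont (t : T) : Continuous fun x : X => t • x := continuous_const_smul t
  have hmap (t : T) : μ.map (fun x => t • x) = μ := by
    ext B hB
    rw [Measure.map_apply (hcont t).measurable hB, hinv t B hB]
  have hmapν (t : T) : ν.map (fun x => t • x) = ν := by
    have : (ν.map fun x => t • x).InnerRegularCompactLTTop :=
      Measure.InnerRegularCompactLTTop.map_of_continuous (hcont t)
    refine Measure.ext_of_integral_eq_on_compactlySupported fun f => ?_
    let g : BoundedContinuousFunction X ℝ := BoundedContinuousFunction.mkOfCompact f.toContinuousMap
    let h : BoundedContinuousFunction X ℝ :=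
      BoundedContinuousFunction.mkOfCompact (f.toContinuousMap.comp ⟨_, hcont t⟩)
    calc ∫ x, f x ∂(ν.map fun x => t • x) = ∫ x, f (t • x) ∂ν :=
        integral_map (hcont t).aemeasurable f.continuous.aestronglyMeasurable
      _ = ∫ x, f (t • x) ∂μ := (hint h).symm
      _ = ∫ x, f x ∂(μ.map fun x => t • x) :=
        (integral_map (hcont t).aemeasurable f.continuous.aestronglyMeasurable).symm
      _ = ∫ x, f x ∂μ := by rw [hmap t]
      _ = ∫ x, f x ∂ν := hint g
  refine ⟨ν, hreg, ⟨?_⟩, fun t B hB => ?_⟩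
  · have h := hint (BoundedContinuousFunction.const X 1)
    simp only [BoundedContinuousFunction.const_apply, integral_const, smul_eq_mul, mul_one,
      measureReal_def, measure_univ, ENNReal.toReal_one] at h
    exact (ENNReal.toReal_eq_one_iff _).1 h.symm
  · rw [← Measure.map_apply (hcont t).measurable hB, hmapν t]

/-- Invariant measures of minimal semiflows charge every nonempty open set. -/
theorem SFInvariantMeasure.measure_ne_zero {μ : Measure X} (hμ : SFInvariantMeasure T μ)
    (hmin : SFMinimal T X) {U : Set X} (hU : IsOpen U) (hne : U.Nonempty) : μ U ≠ 0 := by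
  obtain ⟨hprob, hinv⟩ := hμ
  intro h0
  have hcover : (univ : Set X) ⊆ ⋃ t : T, (fun x => t • x) ⁻¹' U := by
    intro x _
    obtain ⟨_, hz, t, rfl⟩ := (hmin x).inter_open_nonempty U hU hne
    exact mem_iUnion.2 ⟨t, hz⟩
  obtain ⟨s, hs⟩ := isCompact_univ.elim_finite_subcover _
    (fun t : T => hU.preimage (continuous_const_smul t)) hcover
  have : μ (⋃ t ∈ s, (fun x : X => t • x) ⁻¹' U) = 0 :=
    (measure_biUnion_null_iff s.countable_toSet).2 fun t _ => by
      rw [hinv t U hU.measurableSet, h0]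
  have h1 : μ univ = 0 := measure_mono_null hs this
  simp at h1

end Measures

/-- The fibers of a continuous map into a metric space along which the action is nonexpansive
form the fiber relation of an equicontinuous factor. -/
theorem sfIsEqFactorRel_of_nonexpansive {T : Type*} {X M : Type u} [Monoid T]
    [TopologicalSpace T] [TopologicalSpace X] [CompactSpace X] [MulAction T X]
    [ContinuousSMul T X] [MetricSpace M] {φ : X → M} (hφ : Continuous φ)
    (hle : ∀ (t : T) (x x' : X), dist (φ (t • x)) (φ (t • x')) ≤ dist (φ x) (φ x')) :
    SFIsEqFactorRel T X {p : X × X | φ p.1 = φ p.2} := by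
  let σ : range φ → X := fun z => z.2.choose
  have hσ (z : range φ) : φ (σ z) = z := z.2.choose_spec
  have hwd (t : T) {x x' : X} (h : φ x = φ x') : φ (t • x) = φ (t • x') :=
    dist_le_zero.1 ((hle t x x').trans_eq (by rw [h, dist_self]))
  let _ : MulAction T (range φ) :=
    { smul := fun t z => ⟨φ (t • σ z), mem_range_self _⟩
      one_smul := fun z => Subtype.ext (by
        change φ ((1 : T) • σ z) = z
        rw [one_smul, hσ])
      mul_smul := fun s t z => Subtype.ext (by
        change φ ((s * t) • σ z) = φ (s • σ ⟨φ (t • σ z), mem_range_self _⟩)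
        rw [mul_smul]
        exact hwd s (hσ ⟨φ (t • σ z), mem_range_self _⟩).symm) }
  have hsmul (t : T) (z : range φ) : ((t • z : range φ) : M) = φ (t • σ z) := rfl
  have hnon (t : T) (z z' : range φ) : dist (t • z) (t • z') ≤ dist z z' := by
    rw [Subtype.dist_eq, Subtype.dist_eq, hsmul, hsmul, ← hσ z, ← hσ z']
    simpa only [hσ] using hle t (σ z) (σ z')
  have hcs : ContinuousSMul T (range φ) := by
    refine ⟨continuous_iff_continuousAt.2 fun ⟨t, z⟩ => ?_⟩
    rw [ContinuousAt, tendsto_iff_dist_tendsto_zero]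
    have h1 : Tendsto (fun p : T × range φ => dist p.2 z + dist (p.1 • z) (t • z))
        (𝓝 (t, z)) (𝓝 0) := by
      have hc : Continuous fun p : T × range φ => dist p.2 z + dist (p.1 • z) (t • z) := by
        refine (continuous_snd.dist continuous_const).add (Continuous.dist ?_ continuous_const)
        refine Continuous.subtype_mk ?_ _
        exact hφ.comp (continuous_fst.smul continuous_const)
      simpa using hc.tendsto (t, z)
    refine squeeze_zero (fun _ => dist_nonneg) (fun p => ?_) h1
    exact (dist_triangle _ (p.1 • z) _).trans (add_le_add (hnon _ _ _) le_rfl)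
  refine ⟨range φ, inferInstance, isCompact_iff_compactSpace.1 (isCompact_range hφ),
    inferInstance, inferInstance, hcs, rangeFactorization φ, hφ.subtype_mk _,
    rangeFactorization_surjective, fun t x => Subtype.ext ?_, fun ε hε => ?_, ?_⟩
  · exact hwd t (hσ (rangeFactorization φ x)).symm
  · obtain ⟨r, hr, hrε⟩ := Metric.mem_uniformity_dist.1 hε
    exact ⟨{p | dist p.1 p.2 < r}, Metric.dist_mem_uniformity hr,
      fun p hp t => hrε ((hnon t p.1 p.2).trans_lt hp)⟩
  · ext p
    exact (Subtype.ext_iff (a1 := rangeFactorization φ p.1) (a2 := rangeFactorization φ p.2)).symm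

section McMahon

/-- Open neighbourhoods of a section of a closed set contain all nearby sections. -/
theorem eventually_section_subset {X Y : Type*} [TopologicalSpace X] [TopologicalSpace Y]
    [CompactSpace Y] {J : Set (X × Y)} (hJ : IsClosed J) {x : X} {O : Set Y} (hO : IsOpen O)
    (h : Prod.mk x ⁻¹' J ⊆ O) : ∀ᶠ b in 𝓝 x, Prod.mk b ⁻¹' J ⊆ O := by
  have := hO.isClosed_compl.isCompact.eventually_forall_of_forall_eventually (x₀ := x)
    (P := fun b z => (b, z) ∉ J) (fun z hz => hJ.isOpen_compl.mem_nhds fun hJz => hz (h hJz))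
  filter_upwards [this] with b hb z hz
  by_contra hzO
  exact hb z hzO hz

theorem measure_section_le {T X : Type*} [SMul T X] [TopologicalSpace X] [MeasurableSpace X]
    [OpensMeasurableSpace X] {μ : Measure X} (hμ : SFInvariantMeasure T μ)
    {J : Set (X × X)} (hJ : IsClosed J) (hJinv : SFInvariantRel T J) (t : T) (x : X) :
    μ (Prod.mk x ⁻¹' J) ≤ μ (Prod.mk (t • x) ⁻¹' J) := by
  rw [← hμ.2 t _ (hJ.preimage (Continuous.prodMk_right (t • x))).measurableSet]
  exact measure_mono fun z hz => hJinv t _ hz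

variable {T : Type*} {X : Type u} [Monoid T] [TopologicalSpace X] [CompactSpace X] [MulAction T X]
  [MeasurableSpace X] [BorelSpace X]

/-- In a minimal semiflow, the sections of a closed invariant relation have equal measure. -/
theorem measure_section_eq {μ : Measure X} [μ.OuterRegular] (hμ : SFInvariantMeasure T μ)
    (hmin : SFMinimal T X)
    {J : Set (X × X)} (hJ : IsClosed J) (hJinv : SFInvariantRel T J) (x x' : X) :
    μ (Prod.mk x ⁻¹' J) = μ (Prod.mk x' ⁻¹' J) := by
  suffices h : ∀ x x' : X, μ (Prod.mk x ⁻¹' J) ≤ μ (Prod.mk x' ⁻¹' J) from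
    le_antisymm (h x x') (h x' x)
  intro x x'
  refine le_of_forall_gt fun r hr => ?_
  obtain ⟨O, hJO, hO, hOr⟩ := Set.exists_isOpen_lt_of_lt _ r hr
  obtain ⟨_, ⟨t, rfl⟩, hb⟩ := (hmin x).inter_nhds_nonempty (eventually_section_subset hJ hO hJO)
  exact (measure_section_le hμ hJ hJinv t x).trans_lt ((measure_mono hb).trans_lt hOr)

/-- McMahon: the sections of a closed invariant relation vary continuously in measure. -/
theorem tendsto_measure_section_symmDiff {μ : Measure X} [μ.OuterRegular]
    (hμ : SFInvariantMeasure T μ) (hmin : SFMinimal T X)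
    {J : Set (X × X)} (hJ : IsClosed J) (hJinv : SFInvariantRel T J) (x : X) :
    Tendsto (fun b => μ ((Prod.mk b ⁻¹' J) ∆ (Prod.mk x ⁻¹' J))) (𝓝 x) (𝓝 0) := by
  have := hμ.1
  rw [ENNReal.tendsto_nhds_zero]
  intro ε hε
  obtain ⟨O, hJO, hO, hOr⟩ := Set.exists_isOpen_lt_add (μ := μ) (Prod.mk x ⁻¹' J)
    (measure_ne_top _ _) (ENNReal.half_pos hε.ne').ne'
  have hdiff {b : X} (hb : Prod.mk b ⁻¹' J ⊆ O) : μ (O \ (Prod.mk b ⁻¹' J)) ≤ ε / 2 := by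
    rw [measure_sdiff hb (hJ.preimage (Continuous.prodMk_right b)).nullMeasurableSet
      (measure_ne_top _ _), measure_section_eq hμ hmin hJ hJinv b x, tsub_le_iff_left]
    exact hOr.le
  filter_upwards [eventually_section_subset hJ hO hJO] with b hb
  calc μ ((Prod.mk b ⁻¹' J) ∆ (Prod.mk x ⁻¹' J))
      ≤ μ ((O \ (Prod.mk x ⁻¹' J)) ∪ (O \ (Prod.mk b ⁻¹' J))) :=
        measure_mono (union_subset_union (sdiff_subset_sdiff_left hb) (sdiff_subset_sdiff_left hJO))
    _ ≤ ε / 2 + ε / 2 := (measure_union_le _ _).trans (add_le_add (hdiff hJO) (hdiff hb))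
    _ = ε := ENNReal.add_halves ε

theorem measure_section_symmDiff_smul {μ : Measure X} [μ.OuterRegular]
    (hμ : SFInvariantMeasure T μ) (hmin : SFMinimal T X)
    {J : Set (X × X)} (hJ : IsClosed J) (hJinv : SFInvariantRel T J) (t : T) (x x' : X) :
    μ ((Prod.mk (t • x) ⁻¹' J) ∆ (Prod.mk (t • x') ⁻¹' J)) =
      μ ((Prod.mk x ⁻¹' J) ∆ (Prod.mk x' ⁻¹' J)) := by
  have := hμ.1
  have hm (y : X) : MeasurableSet (Prod.mk y ⁻¹' J) :=
    (hJ.preimage (Continuous.prodMk_right y)).measurableSet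
  have key (y : X) :
      Prod.mk y ⁻¹' J =ᵐ[μ] (fun z => t • z) ⁻¹' (Prod.mk (t • y) ⁻¹' J) := by
    refine ae_eq_of_subset_of_measure_ge (fun z hz => hJinv t _ hz) ?_
      (hm y).nullMeasurableSet (measure_ne_top _ _)
    rw [hμ.2 t _ (hm _), measure_section_eq hμ hmin hJ hJinv]
  rw [← hμ.2 t _ ((hm _).symmDiff (hm _)), preimage_symmDiff]
  exact measure_congr ((key x).symmDiff (key x')).symm

/-- Points identified in the maximal equicontinuous factor have almost equal sections in every
closed invariant relation. -/
theorem measure_section_symmDiff_eq_zero [TopologicalSpace T] [ContinuousSMul T X]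
    {μ : Measure X} [μ.OuterRegular]
    (hμ : SFInvariantMeasure T μ) (hmin : SFMinimal T X)
    {J : Set (X × X)} (hJ : IsClosed J) (hJinv : SFInvariantRel T J) {S : Set (X × X)}
    (hS : SFIsEqStructureRel T X S) {x x' : X} (hxx' : (x, x') ∈ S) :
    μ ((Prod.mk x ⁻¹' J) ∆ (Prod.mk x' ⁻¹' J)) = 0 := by
  have := hμ.1
  have hm (y : X) : MeasurableSet (Prod.mk y ⁻¹' J) :=
    (hJ.preimage (Continuous.prodMk_right y)).measurableSet
  let φ : X → Lp ℝ 1 μ := fun y => indicatorConstLp 1 (hm y) (measure_ne_top μ _) 1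
  have hdist (y y' : X) :
      dist (φ y) (φ y') = μ.real ((Prod.mk y ⁻¹' J) ∆ (Prod.mk y' ⁻¹' J)) := by
    rw [dist_indicatorConstLp_eq_norm, norm_indicatorConstLp one_ne_zero ENNReal.one_ne_top]
    simp
  have hφ : Continuous φ := continuous_iff_continuousAt.2 fun y =>
    tendsto_indicatorConstLp_set ENNReal.one_ne_top
      (tendsto_measure_section_symmDiff hμ hmin hJ hJinv y)
  have hR := sfIsEqFactorRel_of_nonexpansive (T := T) hφ fun t y y' => by
    rw [hdist, hdist, measureReal_def, measureReal_def,
      measure_section_symmDiff_smul hμ hmin hJ hJinv]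
  have heq : φ x = φ x' := hS.2 _ hR hxx'
  have h0 := hdist x x'
  rw [heq, dist_self] at h0
  exact (measureReal_eq_zero_iff).1 h0.symm

end McMahon

section AlmostAutomorphic

variable {T X : Type*} [Monoid T] [UniformSpace X] [CompactSpace X] [MulAction T X]

/-- At an almost automorphic point `x`, if `t • x` is near `y` then the fiber of `t` over `y` is
near `x`. -/
theorem SFAAPoint.exists_nhds {x : X} (hx : SFAAPoint T x) {U : Set X} (hU : U ∈ 𝓝 x) (y : X) :
    ∃ W ∈ 𝓝 y, ∀ t : T, t • x ∈ W → ∀ z : X, t • z = y → z ∈ U := by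
  by_contra! hcon
  let A : Set (X × X) → Set X := fun ε => {z | z ∉ U ∧ ∃ t : T, (y, t • x) ∈ ε ∧ t • z = y}
  have hA : Monotone A := fun ε δ h z ⟨hz, t, h1, h2⟩ => ⟨hz, t, h h1, h2⟩
  have hne : ((𝓤 X).lift' A).NeBot := (lift'_neBot_iff hA).2 fun ε hε => by
    obtain ⟨t, ht, z, hz, hzU⟩ := hcon _ (UniformSpace.ball_mem_nhds y hε)
    exact ⟨z, hzU, t, ht, hz⟩
  obtain ⟨x', hx'⟩ := exists_clusterPt_of_compactSpace ((𝓤 X).lift' A)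
  have hfreq {N : Set X} (hN : N ∈ 𝓝 x') {ε : Set (X × X)} (hε : ε ∈ 𝓤 X) :
      (N ∩ A ε).Nonempty := clusterPt_iff_nonempty.1 hx' hN (mem_lift' hε)
  have hxx' : x' = x := hx x' ⟨y, fun ε hε => by
    obtain ⟨z', hz', -, t, h1, h2⟩ := hfreq (UniformSpace.ball_mem_nhds x' hε) hε
    exact ⟨z', t, hz', h1, h2⟩⟩
  obtain ⟨w, hw, hwU, -⟩ := hfreq (hxx' ▸ hU) Filter.univ_mem
  exact hwU hw

/-- Along any sequence in `T` the translates of an almost automorphic point return, through some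
fiber of an earlier element of the sequence, to any given neighbourhood of the point. -/
theorem SFAAPoint.exists_lt [T2Space X] [ContinuousConstSMul T X] {x : X} (hx : SFAAPoint T x)
    {U : Set X} (hU : U ∈ 𝓝 x) (p : ℕ → T) :
    ∃ n m, n < m ∧ ∀ z : X, p n • z = p m • x → z ∈ U := by
  let F : Ultrafilter ℕ := hyperfilter ℕ
  let y : X := (F.map fun m => p m • x).lim
  have hy : Tendsto (fun m => p m • x) F (𝓝 y) := Ultrafilter.le_nhds_lim _
  obtain ⟨W, hW, hWU⟩ := hx.exists_nhds (interior_mem_nhds.2 hU) y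
  obtain ⟨n, hn⟩ := (hy.eventually hW).exists
  have hclosed : IsClosed ((fun z => p n • z) '' (interior U)ᶜ) :=
    (isOpen_interior.isClosed_compl.isCompact.image (continuous_const_smul (p n))).isClosed
  have hmem : ((fun z => p n • z) '' (interior U)ᶜ)ᶜ ∈ 𝓝 y :=
    hclosed.isOpen_compl.mem_nhds fun ⟨z, hzU, hz⟩ => hzU (hWU _ hn z hz)
  have hlt : ∀ᶠ m in (F : Filter ℕ), n < m :=
    (Nat.hyperfilter_le_atTop) (eventually_gt_atTop n)
  obtain ⟨m, hm, hnm⟩ := ((hy.eventually hmem).and hlt).exists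
  refine ⟨n, m, hnm, fun z hz => interior_subset ?_⟩
  by_contra hzU
  exact hm ⟨z, hzU, hz⟩

end AlmostAutomorphic

theorem SFBiContinuous.isOpenMap {T X : Type*} [SMul T X] [UniformSpace X]
    (hbi : SFBiContinuous T X) (t : T) : IsOpenMap fun x : X => t • x := by
  intro U hU
  rw [isOpen_iff_mem_nhds]
  rintro _ ⟨w, hw, rfl⟩
  obtain ⟨ε, hε, hεU⟩ := UniformSpace.mem_nhds_iff.1 (hU.mem_nhds hw)
  obtain ⟨δ, hδ, h⟩ := hbi.2 t (t • w) ε hε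
  filter_upwards [UniformSpace.ball_mem_nhds (t • w) hδ] with x hx
  obtain ⟨z, hz, hwz⟩ := (h x hx).2 w rfl
  exact ⟨z, hεU hwz, hz⟩

/-- If two points are identified in the maximal equicontinuous factor, then in every nonempty open
set some translate of the first point meets the same translate of a neighbourhood of the second. -/
theorem exists_smul_mem_inter_image {T : Type*} {X : Type u} [Monoid T] [TopologicalSpace T]
    [TopologicalSpace X] [CompactSpace X] [T2Space X] [MulAction T X] [ContinuousSMul T X]
    [MeasurableSpace X] [BorelSpace X] (hmin : SFMinimal T X)
    (hmeas : ∃ μ : Measure X, SFInvariantMeasure T μ) {S : Set (X × X)}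
    (hS : SFIsEqStructureRel T X S) {x x' : X} (hxx' : (x, x') ∈ S) {V : Set X} (hV : IsOpen V)
    (hx' : x' ∈ V) {W : Set X} (hW : IsOpen W) (hWne : W.Nonempty) :
    ∃ t : T, t • x ∈ W ∧ (W ∩ (fun z => t • z) '' V).Nonempty := by
  obtain ⟨μ₀, hμ₀⟩ := hmeas
  obtain ⟨μ, hreg, hμ⟩ := hμ₀.exists_regular
  let A : Set (X × X) := {q | ∃ t : T, ∃ v ∈ V, (t • x, t • v) = q}
  have hAinv (s : T) : MapsTo (fun q : X × X => (s • q.1, s • q.2)) A A := by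
    rintro _ ⟨t, v, hv, rfl⟩
    exact ⟨s * t, v, hv, by simp only [mul_smul]⟩
  have hJinv : SFInvariantRel T (closure A) := fun s q hq =>
    (hAinv s).closure (by fun_prop) hq
  have hzero := measure_section_symmDiff_eq_zero hμ hmin isClosed_closure hJinv hS hxx'
  have hx'J : (x', x') ∈ closure A := by
    by_contra hnot
    have hO : IsOpen (V \ (Prod.mk x' ⁻¹' closure A)) :=
      hV.sdiff (isClosed_closure.preimage (Continuous.prodMk_right x'))
    refine hμ.measure_ne_zero hmin hO ⟨x', hx', hnot⟩ (measure_mono_null ?_ hzero)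
    exact fun v hv => Or.inl ⟨subset_closure ⟨1, v, hv.1, by simp only [one_smul]⟩, hv.2⟩
  obtain ⟨_, hsW, s, rfl⟩ := (hmin x').inter_open_nonempty W hW hWne
  obtain ⟨_, ⟨h1, h2⟩, t, v, hv, rfl⟩ :=
    mem_closure_iff.1 (hJinv s _ hx'J) (W ×ˢ W) (hW.prod hW) ⟨hsW, hsW⟩
  exact ⟨t, h1, t • v, h2, v, hv, rfl⟩

/-- An almost automorphic point is alone in its fiber over the maximal equicontinuous factor. -/
theorem SFAAPoint.eq_of_mem_eqStructureRel {T : Type*} {X : Type u} [Monoid T]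
    [TopologicalSpace T] [UniformSpace X] [CompactSpace X] [T2Space X] [MulAction T X]
    [ContinuousSMul T X] [MeasurableSpace X] [BorelSpace X] (hmin : SFMinimal T X)
    (hopen : ∀ t : T, IsOpenMap fun x : X => t • x)
    (hmeas : ∃ μ : Measure X, SFInvariantMeasure T μ) {S : Set (X × X)}
    (hS : SFIsEqStructureRel T X S) {x x' : X} (hx : SFAAPoint T x) (hxx' : (x, x') ∈ S) :
    x' = x := by
  by_contra hne
  obtain ⟨V, U, hV, hU, hx'V, hxU, hdisj⟩ := t2_separation hne
  let N : Type _ := {O : Set X // IsOpen O ∧ O.Nonempty}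
  choose τ hτx hτV using fun O : N =>
    exists_smul_mem_inter_image hmin hmeas hS hxx' hV hx'V O.2.1 O.2.2
  let next : N → N := fun O => ⟨_, O.2.1.inter (hopen (τ O) V hV), hτV O⟩
  let O : ℕ → N := fun n => next^[n] ⟨univ, isOpen_univ, ⟨x, mem_univ x⟩⟩
  have hO (n : ℕ) : (O (n + 1)).1 = (O n).1 ∩ (fun z => τ (O n) • z) '' V := by
    simp only [O, Function.iterate_succ_apply']
    rfl
  have hanti : Antitone fun n => (O n).1 :=
    antitone_nat_of_succ_le fun n => (hO n).trans_subset inter_subset_left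
  obtain ⟨n, m, hnm, h⟩ := hx.exists_lt (hU.mem_nhds hxU) fun n => τ (O n)
  have hmem : τ (O m) • x ∈ (O (n + 1)).1 := hanti hnm (hτx (O m))
  rw [hO] at hmem
  obtain ⟨z, hzV, hz⟩ := hmem.2
  exact disjoint_left.1 hdisj hzV (h z hz)

section Equicontinuous

variable {T Y : Type*} [Monoid T] [UniformSpace Y] [CompactSpace Y] [MulAction T Y]

/-- In a surjective equicontinuous semiflow each `t` is uniformly recurrent to the identity. -/
theorem SFEquicontinuous.exists_pow (heq : SFEquicontinuous T Y)
    (hsurj : ∀ t : T, Surjective fun y : Y => t • y) (t : T) {ε : Set (Y × Y)} (hε : ε ∈ 𝓤 Y) :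
    ∃ n : ℕ, ∀ y : Y, (y, t ^ (n + 1) • y) ∈ ε := by
  obtain ⟨ε₁, hε₁, -, hcomp₁⟩ := comp_symm_mem_uniformity_sets hε
  obtain ⟨ε₂, hε₂, hsymm, hcomp₂⟩ := comp_symm_mem_uniformity_sets hε₁
  obtain ⟨δ, hδ, hδε⟩ := heq ε₂ hε₂
  obtain ⟨s, -, hs⟩ := isCompact_univ.elim_nhds_subcover (fun c : Y => UniformSpace.ball c δ)
    fun c _ => UniformSpace.ball_mem_nhds c hδ
  let F : Ultrafilter ℕ := hyperfilter ℕ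
  let g : Y → Y := fun c => (F.map fun n => t ^ n • c).lim
  have hg (c : Y) : Tendsto (fun n => t ^ n • c) F (𝓝 (g c)) := Ultrafilter.le_nhds_lim _
  have hev : ∀ᶠ n in (F : Filter ℕ), ∀ c ∈ s, (g c, t ^ n • c) ∈ ε₂ :=
    (Filter.eventually_all_finset s).2 fun c _ => hg c (UniformSpace.ball_mem_nhds _ hε₂)
  obtain ⟨n, hn⟩ := hev.exists
  have hlt : ∀ᶠ m in (F : Filter ℕ), n < m := Nat.hyperfilter_le_atTop (eventually_gt_atTop n)
  obtain ⟨m, hm, hnm⟩ := (hev.and hlt).exists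
  obtain ⟨k, rfl⟩ := Nat.exists_eq_add_of_lt hnm
  refine ⟨k, fun z => ?_⟩
  obtain ⟨y, rfl⟩ := hsurj (t ^ n) z
  obtain ⟨c, hc, hy⟩ := mem_iUnion₂.1 (hs (mem_univ y))
  have hpow : t ^ (k + 1) • t ^ n • y = t ^ (n + k + 1) • y := by
    rw [smul_smul, ← pow_add]
    congr 2
    omega
  change (t ^ n • y, t ^ (k + 1) • t ^ n • y) ∈ ε
  rw [hpow]
  exact hcomp₁ ⟨g c,
    hcomp₂ ⟨t ^ n • c, hsymm.symm _ _ (hδε _ hy (t ^ n)), hsymm.symm _ _ (hn c hc)⟩,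
    hcomp₂ ⟨t ^ (n + k + 1) • c, hm c hc, hδε _ hy _⟩⟩

/-- Surjective equicontinuous semiflows have uniformly equicontinuous inverses. -/
theorem SFEquicontinuous.exists_symm (heq : SFEquicontinuous T Y)
    (hsurj : ∀ t : T, Surjective fun y : Y => t • y) {ε : Set (Y × Y)} (hε : ε ∈ 𝓤 Y) :
    ∃ δ ∈ 𝓤 Y, ∀ (t : T) (y y' : Y), (t • y, t • y') ∈ δ → (y, y') ∈ ε := by
  obtain ⟨ε₁, hε₁, hsymm, hcomp⟩ := comp_comp_symm_mem_uniformity_sets hε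
  obtain ⟨δ, hδ, hδε⟩ := heq ε₁ hε₁
  refine ⟨δ, hδ, fun t y y' h => ?_⟩
  obtain ⟨n, hn⟩ := heq.exists_pow hsurj t hε₁
  have hmid := hδε _ h (t ^ n)
  simp only [smul_smul, ← pow_succ] at hmid
  exact hcomp ⟨_, ⟨_, hn y, hmid⟩, hsymm.symm _ _ (hn y')⟩

end Equicontinuous

/-- A singleton fiber over a surjective equicontinuous factor consists of an almost automorphic
point. -/
theorem sfAAPoint_of_preimage_eq_singleton {T X Y : Type*} [Monoid T] [UniformSpace X]
    [CompactSpace X] [MulAction T X] [UniformSpace Y] [CompactSpace Y] [T2Space Y]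
    [MulAction T Y] (hsurjY : ∀ t : T, Surjective fun y : Y => t • y)
    (heq : SFEquicontinuous T Y) {π : X → Y} (hcont : Continuous π)
    (hequiv : ∀ (t : T) (x : X), π (t • x) = t • π x) {y : Y} {x : X}
    (hx : π ⁻¹' {y} = {x}) : SFAAPoint T x := by
  have hxy : π x = y := hx.ge rfl
  rintro x' ⟨z, hz⟩
  suffices h : π x' = π x from hx.le (h.trans hxy)
  refine eq_of_uniformity fun {ε} hε => ?_
  obtain ⟨ε₁, hε₁, -, hcomp⟩ := comp_symm_mem_uniformity_sets hε
  obtain ⟨δ, hδ, hδε⟩ := heq.exists_symm hsurjY hε₁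
  have hπ := CompactSpace.uniformContinuous_of_continuous hcont
  obtain ⟨x'', t, h1, h2, rfl⟩ := hz _ (inter_mem (hπ hε₁) (hπ hδ))
  refine hcomp ⟨π x'', h1.1, hδε t _ _ ?_⟩
  simpa only [mem_preimage, hequiv] using h2.2

/-- A minimal bi-continuous semiflow `(T,X)` admitting an invariant
measure is almost automorphic iff the canonical projection onto its maximal
equicontinuous factor is of almost 1-1 type. -/
theorem stmt18 (T : Type*) (X : Type u) [Monoid T] [TopologicalSpace T]
    [UniformSpace X] [CompactSpace X] [T2Space X]
    [MulAction T X] [ContinuousSMul T X]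
    [MeasurableSpace X] [BorelSpace X]
    (hmin : SFMinimal T X)
    (hbi : SFBiContinuous T X)
    (hmeas : ∃ μ : Measure X, SFInvariantMeasure T μ)
    -- `(Y, π)` is a realization of the maximal equicontinuous factor `(T, X_eq)`:
    (Y : Type u) [UniformSpace Y] [CompactSpace Y] [T2Space Y]
    [MulAction T Y] [ContinuousSMul T Y]
    (π : X → Y) (hcont : Continuous π) (hsurj : Function.Surjective π)
    (hequiv : ∀ (t : T) (x : X), π (t • x) = t • π x)
    (heq : SFEquicontinuous T Y)
    (hmax : SFIsEqStructureRel T X {p : X × X | π p.1 = π p.2}) :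
    (∃ x : X, SFAAPoint T x ∧ Dense (orbitSet T x)) ↔
      (∃ (y : Y) (x : X), π ⁻¹' {y} = {x}) := by
  constructor
  · rintro ⟨x, hx, -⟩
    refine ⟨π x, x, Subset.antisymm (fun x' hx' => ?_) (singleton_subset_iff.2 rfl)⟩
    exact hx.eq_of_mem_eqStructureRel hmin hbi.isOpenMap hmeas hmax (Eq.symm hx')
  · rintro ⟨y, x, hx⟩
    refine ⟨x, sfAAPoint_of_preimage_eq_singleton (fun t y => ?_) heq hcont hequiv hx, hmin x⟩
    obtain ⟨a, rfl⟩ := hsurj y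
    obtain ⟨b, rfl⟩ := hbi.1 t a
    exact ⟨π b, (hequiv t b).symm⟩
end
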